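/- Let X be a finite non-empty set with an imprecise probability tree and associated game-theoretic upper expectation Ē_V. For any situation s ∈ X* and any non-decreasing sequence {f_n}_{n∈ℕ₀} of bounded-below extended-real variables on Ω converging pointwise to a (necessarily bounded-below) variable f, one has Ē_V(f|s) = lim_{n→∞} Ē_V(f_n|s). -/

import Mathlib

open Filter Topology

/-- A function to the extended reals is bounded below by some real number. -/
def BddBelowF {Y : Type*} (f : Y → EReal) : Prop :=
  ∃ M : ℝ, ∀ y, (M : EReal) ≤ f y

/-- An upper expectation on the bounded-below extended-real functions on `Y`:
axioms E1 (constants), E2 (subadditivity), E3 (positive/`+∞` homogeneity on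
non-negative functions) and E4 (monotonicity). -/
structure IsUpperExpectation {Y : Type*} (E : (Y → EReal) → EReal) : Prop where
  const : ∀ c : ℝ, E (fun _ => (c : EReal)) = (c : EReal)
  subadd : ∀ f g : Y → EReal, BddBelowF f → BddBelowF g →
    E (fun y => f y + g y) ≤ E f + E g
  homog : ∀ lam : EReal, 0 < lam → ∀ f : Y → EReal, BddBelowF f → (∀ y, 0 ≤ f y) →
    E (fun y => lam * f y) = lam * E f
  mono : ∀ f g : Y → EReal, BddBelowF f → BddBelowF g → (∀ y, f y ≤ g y) → E f ≤ E g

/-- The initial segment `ω^n = (ω_1, …, ω_n)` of a path `ω ∈ X^ℕ`. -/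
def seg {X : Type*} (ω : ℕ → X) (n : ℕ) : List X :=
  List.ofFn (fun i : Fin n => ω i)

/-- The cylinder event `Γ(s)` of all paths going through the situation `s`. -/
def cyl {X : Type*} (s : List X) : Set (ℕ → X) :=
  {ω | seg ω s.length = s}

/-- A global variable is `n`-measurable if it only depends on the first `n` states. -/
def NMeas {X α : Type*} (n : ℕ) (f : (ℕ → X) → α) : Prop :=
  ∀ ω ω' : ℕ → X, seg ω n = seg ω' n → f ω = f ω'

/-- A supermartingale for an imprecise probability tree `Q`: a bounded-below
extended-real process `M` on situations such that `Q_s(M(s·)) ≤ M(s)` everywhere. -/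
def IsSupermartingale {X : Type*} (Q : List X → (X → EReal) → EReal)
    (M : List X → EReal) : Prop :=
  (∃ B : ℝ, ∀ s, (B : EReal) ≤ M s) ∧ ∀ s, Q s (fun x => M (s ++ [x])) ≤ M s

/-- The game-theoretic upper expectation `Ē_V(f | s)`. -/
noncomputable def gUE {X : Type*} (Q : List X → (X → EReal) → EReal)
    (f : (ℕ → X) → EReal) (s : List X) : EReal :=
  sInf { y | ∃ M : List X → EReal, IsSupermartingale Q M ∧
    (∀ ω ∈ cyl s, f ω ≤ Filter.liminf (fun n => M (seg ω n)) Filter.atTop) ∧ M s = y }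

theorem seg_length {X : Type*} (ω : ℕ → X) (n : ℕ) : (seg ω n).length = n := by
  simp [seg]

theorem seg_succ {X : Type*} (ω : ℕ → X) (n : ℕ) : seg ω (n + 1) = seg ω n ++ [ω n] := by
  simp only [seg, List.ofFn_succ_last, Fin.val_castSucc, Fin.val_last]

theorem seg_prefix_seg {X : Type*} (ω : ℕ → X) {m n : ℕ} (h : m ≤ n) :
    seg ω m <+: seg ω n := by
  induction n, h using Nat.le_induction with
  | base => exact List.prefix_refl _
  | succ n _ ih => exact ih.trans (seg_succ ω n ▸ List.prefix_append _ _)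

theorem seg_eq_of_isPrefix {X : Type*} {ω : ℕ → X} {n : ℕ} {t : List X} (h : t <+: seg ω n) :
    seg ω t.length = t := by
  have hl : t.length ≤ n := by simpa [seg_length] using h.length_le
  exact (List.prefix_of_prefix_length_le (seg_prefix_seg ω hl) h
    (by simp [seg_length])).eq_of_length (by simp [seg_length])

theorem mem_cyl_of_isPrefix {X : Type*} {ω : ℕ → X} {t u : List X} (h : t <+: u)
    (hω : ω ∈ cyl u) : ω ∈ cyl t := by
  refine seg_eq_of_isPrefix (n := u.length) ?_
  rwa [show seg ω u.length = u from hω]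

theorem BddBelowF.of_nonneg {Y : Type*} {f : Y → EReal} (h : ∀ y, 0 ≤ f y) : BddBelowF f :=
  ⟨0, by simpa using h⟩

theorem BddBelowF.const {Y : Type*} (c : ℝ) : BddBelowF (fun _ : Y => (c : EReal)) :=
  ⟨c, fun _ => le_rfl⟩

/-- Continuity from below of a local upper expectation on a finite space. -/
theorem IsUpperExpectation.apply_iSup_le {Y : Type*} [Finite Y] {E : (Y → EReal) → EReal}
    (hE : IsUpperExpectation E) {h : ℕ → Y → EReal} (hm : Monotone h) (h0 : ∀ n y, 0 ≤ h n y) :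
    E (fun y => ⨆ n, h n y) ≤ ⨆ n, E (h n) := by
  classical
  obtain ⟨L, hL⟩ : ∃ L, L = ⨆ n, E (h n) := ⟨_, rfl⟩
  rw [← hL]
  have hEL : ∀ n, E (h n) ≤ L := fun n => hL ▸ le_iSup (fun n => E (h n)) n
  clear hL
  have hnn : ∀ f : Y → EReal, (∀ y, 0 ≤ f y) → 0 ≤ E f := fun f hf => by
    have := hE.mono (fun _ => ((0 : ℝ) : EReal)) f (.const 0) (.of_nonneg hf) (by simpa using hf)
    rwa [hE.const] at this
  by_cases hLt : L = ⊤
  · rw [hLt]; exact le_top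
  have hL0 : 0 ≤ L := (hnn _ (h0 0)).trans (hEL 0)
  have hsup0 : ∀ y, 0 ≤ ⨆ n, h n y := fun y => (h0 0 y).trans (le_iSup (fun n => h n y) 0)
  set I : Y → EReal := fun y => if ⨆ n, h n y = ⊤ then 1 else 0 with hI
  set hfin : Y → EReal := fun y => if ⨆ n, h n y = ⊤ then 0 else ⨆ n, h n y with hfin_def
  have hI0 : ∀ y, 0 ≤ I y := fun y => by simp only [hI]; split_ifs <;> simp
  have hfin_nonneg : ∀ y, 0 ≤ hfin y := fun y => by simp only [hfin_def]; split_ifs <;> simp [hsup0]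
  have hEI : E I = 0 := by
    refine le_antisymm ?_ (hnn _ hI0)
    have hbound : ∀ c : ℝ, 0 < c → (c : EReal) * E I ≤ L := by
      intro c hc
      have hev : ∀ᶠ n in atTop, ∀ y, (c : EReal) * I y ≤ h n y := by
        rw [eventually_all]
        intro y
        by_cases hy : ⨆ n, h n y = ⊤
        · have := (tendsto_atTop_iSup (fun m n hmn => hm hmn y)).eventually_const_lt
            (show (c : EReal) < ⨆ n, h n y by rw [hy]; exact EReal.coe_lt_top c)
          filter_upwards [this] with n hn
          simpa [hI, hy] using hn.le
        · exact Eventually.of_forall fun n => by simpa [hI, hy] using h0 n y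
      obtain ⟨n, hn⟩ := hev.exists
      have hc' : (0 : EReal) < c := by exact_mod_cast hc
      rw [← hE.homog c hc' I (.of_nonneg hI0) hI0]
      exact (hE.mono _ _ (.of_nonneg fun y => mul_nonneg hc'.le (hI0 y))
        (.of_nonneg (h0 n)) hn).trans (hEL n)
    by_contra hpos
    push Not at hpos
    lift L to ℝ using ⟨hLt, ne_bot_of_le_ne_bot (by simp) hL0⟩
    have hItop : E I ≠ ⊤ := by
      intro htop
      have := hbound 1 one_pos
      rw [htop] at this
      simp at this
    generalize E I = e at *
    lift e to ℝ using ⟨hItop, hpos.ne_bot⟩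
    have he : 0 < e := by exact_mod_cast hpos
    have hl : 0 ≤ L := by exact_mod_cast hL0
    have := hbound ((L + 1) / e) (by positivity)
    rw [← EReal.coe_mul, div_mul_cancel₀ _ he.ne', EReal.coe_le_coe_iff] at this
    linarith
  have hEfin : E hfin ≤ L := by
    refine EReal.le_of_forall_lt_iff_le.1 fun r hr => ?_
    lift L to ℝ using ⟨hLt, ne_bot_of_le_ne_bot (by simp) hL0⟩
    have hlr : L < r := by exact_mod_cast hr
    have hev : ∀ᶠ n in atTop, ∀ y, hfin y ≤ h n y + ((r - L : ℝ) : EReal) := by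
      rw [eventually_all]
      intro y
      by_cases hy : ⨆ n, h n y = ⊤
      · refine Eventually.of_forall fun n => ?_
        simp only [hfin_def, hy, if_true]
        exact add_nonneg (h0 n y) (by exact_mod_cast (sub_pos.2 hlr).le)
      · have ht := tendsto_atTop_iSup (fun m n hmn => hm hmn y)
        have hs0 := hsup0 y
        simp only [hfin_def, hy, if_false]
        generalize (⨆ n, h n y) = z at *
        lift z to ℝ using ⟨hy, ne_bot_of_le_ne_bot (by simp) hs0⟩
        have := ht.eventually_const_lt
          (show ((z - (r - L) : ℝ) : EReal) < z by exact_mod_cast (by linarith))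
        filter_upwards [this] with n hn
        calc (z : EReal) = ((z - (r - L) : ℝ) : EReal) + ((r - L : ℝ) : EReal) := by
              rw [← EReal.coe_add]; congr 1; ring
          _ ≤ _ := by gcongr
    obtain ⟨n, hn⟩ := hev.exists
    have hc : (0 : EReal) ≤ ((r - L : ℝ) : EReal) := by exact_mod_cast (sub_pos.2 hlr).le
    calc E hfin ≤ E (fun y => h n y + ((r - L : ℝ) : EReal)) :=
          hE.mono _ _ (.of_nonneg hfin_nonneg) (.of_nonneg fun y => add_nonneg (h0 n y) hc) hn
      _ ≤ E (h n) + E (fun _ => ((r - L : ℝ) : EReal)) :=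
          hE.subadd _ _ (.of_nonneg (h0 n)) (.const _)
      _ ≤ L + ((r - L : ℝ) : EReal) := by
          rw [hE.const]; gcongr; exact hEL n
      _ = r := by rw [← EReal.coe_add]; congr 1; ring
  have hTI0 : ∀ y, 0 ≤ (⊤ : EReal) * I y := fun y => mul_nonneg le_top (hI0 y)
  calc E (fun y => ⨆ n, h n y) ≤ E (fun y => hfin y + ⊤ * I y) := by
        refine hE.mono _ _ (.of_nonneg hsup0)
          (.of_nonneg fun y => add_nonneg (hfin_nonneg y) (hTI0 y)) fun y => ?_
        simp only [hfin_def, hI]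
        split_ifs with hy <;> simp
    _ ≤ E hfin + E (fun y => ⊤ * I y) := hE.subadd _ _ (.of_nonneg hfin_nonneg) (.of_nonneg hTI0)
    _ = E hfin := by
        rw [hE.homog ⊤ (by simp) I (.of_nonneg hI0) hI0, hEI]; simp
    _ ≤ L := hEfin

/-- A non-negative supermartingale. -/
def IsNonnegSupermartingale {X : Type*} (Q : List X → (X → EReal) → EReal)
    (M : List X → EReal) : Prop :=
  (∀ u, 0 ≤ M u) ∧ ∀ u, Q u (fun x => M (u ++ [x])) ≤ M u

section Supermartingale

variable {X : Type*} {Q : List X → (X → EReal) → EReal}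

theorem IsNonnegSupermartingale.isSupermartingale {M : List X → EReal}
    (h : IsNonnegSupermartingale Q M) : IsSupermartingale Q M :=
  ⟨⟨0, by simpa using h.1⟩, h.2⟩

theorem IsNonnegSupermartingale.const (hQ : ∀ s, IsUpperExpectation (Q s)) {c : ℝ} (hc : 0 ≤ c) :
    IsNonnegSupermartingale Q (fun _ => (c : EReal)) :=
  ⟨fun _ => EReal.coe_nonneg.2 hc, fun u => ((hQ u).const c).le⟩

theorem IsNonnegSupermartingale.add (hQ : ∀ s, IsUpperExpectation (Q s)) {M N : List X → EReal}
    (hM : IsNonnegSupermartingale Q M) (hN : IsNonnegSupermartingale Q N) :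
    IsNonnegSupermartingale Q (fun u => M u + N u) :=
  ⟨fun u => add_nonneg (hM.1 u) (hN.1 u), fun u =>
    ((hQ u).subadd _ _ (.of_nonneg fun _ => hM.1 _) (.of_nonneg fun _ => hN.1 _)).trans
      (add_le_add (hM.2 u) (hN.2 u))⟩

theorem IsNonnegSupermartingale.const_mul (hQ : ∀ s, IsUpperExpectation (Q s))
    {M : List X → EReal} (hM : IsNonnegSupermartingale Q M) {c : ℝ} (hc : 0 < c) :
    IsNonnegSupermartingale Q (fun u => (c : EReal) * M u) := by
  have hc' : (0 : EReal) < c := by exact_mod_cast hc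
  refine ⟨fun u => mul_nonneg hc'.le (hM.1 u), fun u => ?_⟩
  rw [(hQ u).homog c hc' _ (.of_nonneg fun _ => hM.1 _) fun _ => hM.1 _]
  exact mul_le_mul_of_nonneg_left (hM.2 u) hc'.le

theorem IsNonnegSupermartingale.sum (hQ : ∀ s, IsUpperExpectation (Q s))
    {M : ℕ → List X → EReal} (hM : ∀ n, IsNonnegSupermartingale Q (M n)) (n : ℕ) :
    IsNonnegSupermartingale Q (fun u => ∑ i ∈ Finset.range n, M i u) := by
  induction n with
  | zero => simpa using IsNonnegSupermartingale.const hQ le_rfl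
  | succ n ih => simpa only [Finset.sum_range_succ] using ih.add hQ (hM n)

theorem IsNonnegSupermartingale.iSup [Finite X] (hQ : ∀ s, IsUpperExpectation (Q s))
    {M : ℕ → List X → EReal} (hM : ∀ n, IsNonnegSupermartingale Q (M n)) (hm : Monotone M) :
    IsNonnegSupermartingale Q (fun u => ⨆ n, M n u) :=
  ⟨fun u => ((hM 0).1 u).trans (le_iSup (fun n => M n u) 0), fun u =>
    ((hQ u).apply_iSup_le (h := fun n x => M n (u ++ [x])) (fun _ _ h _ => hm h _)
      fun n _ => (hM n).1 _).trans (iSup_mono fun n => (hM n).2 u)⟩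

/-- Switching between non-negative supermartingales without ever gaining capital at a switch
again yields a non-negative supermartingale. -/
theorem IsNonnegSupermartingale.switch (hQ : ∀ s, IsUpperExpectation (Q s))
    {C : List X → List X → EReal} (hC : ∀ u, IsNonnegSupermartingale Q (C u))
    (hsw : ∀ u x, C (u ++ [x]) (u ++ [x]) ≤ C u (u ++ [x])) :
    IsNonnegSupermartingale Q (fun u => C u u) :=
  ⟨fun u => (hC u).1 u, fun u =>
    ((hQ u).mono _ _ (.of_nonneg fun _ => (hC _).1 _) (.of_nonneg fun _ => (hC _).1 _)
      (hsw u)).trans ((hC u).2 u)⟩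

theorem IsSupermartingale.add_const (hQ : ∀ s, IsUpperExpectation (Q s)) {M : List X → EReal}
    (hM : IsSupermartingale Q M) (c : ℝ) : IsSupermartingale Q (fun u => M u + c) := by
  obtain ⟨⟨B, hB⟩, hs⟩ := hM
  refine ⟨⟨B + c, fun u => ?_⟩, fun u => ?_⟩
  · rw [EReal.coe_add]; exact add_le_add_left (hB u) _
  · refine ((hQ u).subadd _ _ ⟨B, fun _ => hB _⟩ (.const c)).trans ?_
    rw [(hQ u).const]
    exact add_le_add_left (hs u) _

theorem IsSupermartingale.exists_le [Finite X] [Nonempty X]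
    (hQ : ∀ s, IsUpperExpectation (Q s)) {M : List X → EReal} (hM : IsSupermartingale Q M)
    (u : List X) : ∃ x, M (u ++ [x]) ≤ M u := by
  by_contra! hlt
  obtain ⟨x₀, hx₀⟩ := Finite.exists_min (fun x => M (u ++ [x]))
  obtain ⟨r, hr₁, hr₂⟩ := EReal.lt_iff_exists_real_btwn.1 (hlt x₀)
  have := (hQ u).mono (fun _ => (r : EReal)) (fun x => M (u ++ [x])) (.const r)
    (hM.1.imp fun B hB _ => hB _) fun x => hr₂.le.trans (hx₀ x)
  rw [(hQ u).const] at this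
  exact absurd (this.trans (hM.2 u)) (not_le.2 hr₁)

theorem IsSupermartingale.le_of_le_liminf [Finite X] [Nonempty X]
    (hQ : ∀ s, IsUpperExpectation (Q s)) {M : List X → EReal} (hM : IsSupermartingale Q M)
    {t : List X} {c : EReal}
    (h : ∀ ω ∈ cyl t, c ≤ liminf (fun n => M (seg ω n)) atTop) : c ≤ M t := by
  choose next hnext using hM.exists_le hQ
  let U : ℕ → List X := fun k => k.rec t fun _ u => u ++ [next u]
  have hU : ∀ k, U (k + 1) = U k ++ [next (U k)] := fun _ => rfl
  have hlen : ∀ k, (U k).length = t.length + k := fun k => by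
    induction k with
    | zero => rfl
    | succ k ih => simp [hU, ih, add_assoc]
  have hpre : ∀ {j k}, j ≤ k → U j <+: U k := fun {j k} hjk => by
    induction k, hjk using Nat.le_induction with
    | base => exact List.prefix_refl _
    | succ k _ ih => exact ih.trans (hU k ▸ List.prefix_append _ _)
  have hMU : ∀ k, M (U k) ≤ M t := fun k => by
    induction k with
    | zero => exact le_rfl
    | succ k ih => exact (hnext _).trans ih
  let ω : ℕ → X := fun i => (U (i + 1))[i]'(by have := hlen (i + 1); omega)
  have hω : ∀ k, seg ω (t.length + k) = U k := fun k => by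
    refine List.ext_getElem (by simp [seg_length, hlen]) fun i h₁ h₂ => ?_
    simp only [seg, List.getElem_ofFn, ω]
    rcases le_total (i + 1) k with hik | hik
    · exact (hpre hik).getElem _
    · exact ((hpre hik).getElem _).symm
  refine (h ω (hω 0)).trans ?_
  refine liminf_le_of_frequently_le' (Eventually.frequently ?_)
  filter_upwards [eventually_ge_atTop t.length] with n hn
  obtain ⟨k, rfl⟩ := Nat.exists_eq_add_of_le hn
  rw [hω]
  exact hMU k

theorem gUE_mono {f g : (ℕ → X) → EReal} (h : ∀ ω, f ω ≤ g ω) (s : List X) :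
    gUE Q f s ≤ gUE Q g s :=
  sInf_le_sInf fun _ ⟨M, hM, hl, hy⟩ => ⟨M, hM, fun ω hω => (h ω).trans (hl ω hω), hy⟩

theorem isNonnegSupermartingale_gUE [Finite X] [Nonempty X]
    (hQ : ∀ s, IsUpperExpectation (Q s)) {f : (ℕ → X) → EReal} (hf : ∀ ω, 0 ≤ f ω) :
    IsNonnegSupermartingale Q (gUE Q f) := by
  have h0 : ∀ u, 0 ≤ gUE Q f u := fun u => le_sInf fun y ⟨M, hM, hl, hy⟩ =>
    hy ▸ hM.le_of_le_liminf hQ fun ω hω => (hf ω).trans (hl ω hω)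
  refine ⟨h0, fun u => le_sInf fun y ⟨M, hM, hl, hy⟩ => ?_⟩
  rw [← hy]
  refine le_trans ?_ (hM.2 u)
  refine (hQ u).mono _ _ (.of_nonneg fun _ => h0 _) (hM.1.imp fun B hB _ => hB _) fun x => ?_
  exact sInf_le ⟨M, hM, fun ω hω => hl ω (mem_cyl_of_isPrefix (List.prefix_append _ _) hω), rfl⟩

theorem exists_nonnegSupermartingale_of_gUE_lt [Finite X] [Nonempty X]
    (hQ : ∀ s, IsUpperExpectation (Q s)) {f : (ℕ → X) → EReal} (hf : ∀ ω, 0 ≤ f ω)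
    {t : List X} {a : EReal} (h : gUE Q f t < a) :
    ∃ M, IsNonnegSupermartingale Q M ∧ M t ≤ a ∧
      ∀ ω ∈ cyl t, f ω ≤ liminf (fun n => M (seg ω n)) atTop := by
  classical
  obtain ⟨y, ⟨M, hM, hl, rfl⟩, hy⟩ := sInf_lt_iff.1 h
  refine ⟨fun u => if t <+: u then M u else ⊤, ⟨fun u => ?_, fun u => ?_⟩, ?_, fun ω hω => ?_⟩
  · dsimp only
    split_ifs with htu
    · exact hM.le_of_le_liminf hQ fun ω hω =>
        (hf ω).trans (hl ω (mem_cyl_of_isPrefix htu hω))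
    · exact le_top
  · by_cases htu : t <+: u
    · simpa [htu, fun x => htu.trans (List.prefix_append u [x])] using hM.2 u
    · simp [htu]
  · simpa using hy.le
  · refine (hl ω hω).trans_eq (liminf_congr ?_)
    filter_upwards [eventually_ge_atTop t.length] with n hn
    have : t <+: seg ω n := by
      have := seg_prefix_seg ω hn
      rwa [show seg ω t.length = t from hω] at this
    simp [this]

/-- Fix levels `a < b`. Repeatedly betting that `f` exceeds `b`, starting whenever its upper
expectation is below `a`, and setting aside the gain after each success, makes the capital
diverge on every path where `f` exceeds `b` while its upper expectation drops below `a`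
infinitely often. -/
theorem exists_nonnegSupermartingale_tendsto_top [Finite X] [Nonempty X]
    (hQ : ∀ s, IsUpperExpectation (Q s)) {f : (ℕ → X) → EReal} (hf : ∀ ω, 0 ≤ f ω)
    (s : List X) {a b ε : ℝ} (hab : a < b) (hε : 0 < ε) :
    ∃ T, IsNonnegSupermartingale Q T ∧ T s ≤ ε ∧ ∀ ω, (b : EReal) < f ω →
      (∃ᶠ n in atTop, gUE Q f (seg ω n) < a) →
        Tendsto (fun n => T (seg ω n)) atTop (𝓝 ⊤) := by
  classical
  rcases le_or_gt a 0 with ha | ha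
  · refine ⟨fun _ => 0, by simpa using IsNonnegSupermartingale.const hQ le_rfl,
      EReal.coe_nonneg.2 hε.le, fun ω _ hfr => ?_⟩
    obtain ⟨n, hn⟩ := hfr.exists
    exact absurd (hn.trans_le (by exact_mod_cast ha))
      (not_lt.2 ((isNonnegSupermartingale_gUE hQ hf).1 _))
  have hex : ∀ t, ∃ M, IsNonnegSupermartingale Q M ∧ (gUE Q f t < a → M t ≤ a ∧
      ∀ ω ∈ cyl t, f ω ≤ liminf (fun n => M (seg ω n)) atTop) := fun t => by
    by_cases ht : gUE Q f t < a
    · obtain ⟨M, h₁, h₂⟩ := exists_nonnegSupermartingale_of_gUE_lt hQ hf ht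
      exact ⟨M, h₁, fun _ => h₂⟩
    · exact ⟨_, IsNonnegSupermartingale.const hQ le_rfl, fun h => absurd h ht⟩
  choose M hM hMt using hex
  -- A state records the number of successes and, during a bet, the situation where it started.
  let step : List X → ℕ × Option (List X) → ℕ × Option (List X) := fun u σ =>
    match σ with
    | (k, none) => if s.length < u.length ∧ gUE Q f u < a then (k, some u) else (k, none)
    | (k, some t) => if (b : EReal) < M t u then (k + 1, none) else (k, some t)
  obtain ⟨st, st_nil, st_concat⟩ : ∃ st : List X → ℕ × Option (List X), st [] = (0, none) ∧
      ∀ u x, st (u ++ [x]) = step (u ++ [x]) (st u) :=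
    ⟨fun u => List.reverseRecOn u (0, none) fun l x σ => step (l ++ [x]) σ,
      by simp, fun u x => by simp⟩
  let val : ℕ × Option (List X) → List X → EReal := fun σ u =>
    match σ with
    | (k, none) => ((k * (b - a) : ℝ) : EReal) + (a : EReal)
    | (k, some t) => ((k * (b - a) : ℝ) : EReal) + M t u
  have hk0 : ∀ k : ℕ, 0 ≤ k * (b - a) := fun k => mul_nonneg k.cast_nonneg (sub_pos.2 hab).le
  have hval : ∀ σ, IsNonnegSupermartingale Q (val σ) := by
    rintro ⟨k, _ | t⟩
    · exact (IsNonnegSupermartingale.const hQ (hk0 k)).add hQ (.const hQ ha.le)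
    · exact (IsNonnegSupermartingale.const hQ (hk0 k)).add hQ (hM t)
  have hstep : ∀ σ u, val (step u σ) u ≤ val σ u := by
    rintro ⟨k, _ | t⟩ u
    · by_cases hu : s.length < u.length ∧ gUE Q f u < a
      · simp only [step, val, hu, and_self, if_true]
        gcongr
        exact (hMt u hu.2).1
      · simp only [step, val, hu, if_false, le_refl]
    · by_cases hu : (b : EReal) < M t u
      · simp only [step, val, hu, if_true]
        calc (((k + 1 : ℕ) * (b - a) : ℝ) : EReal) + (a : EReal)
            = ((k * (b - a) : ℝ) : EReal) + (b : EReal) := by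
              rw [← EReal.coe_add, ← EReal.coe_add]; congr 1; push_cast; ring
          _ ≤ _ := by gcongr
      · simp only [step, val, hu, if_false, le_refl]
  have hK : IsNonnegSupermartingale Q (fun u => val (st u) u) :=
    IsNonnegSupermartingale.switch hQ (C := fun u => val (st u)) (fun u => hval _)
      fun u x => by rw [st_concat]; exact hstep _ _
  have hst_short : ∀ u : List X, u.length ≤ s.length → st u = (0, none) := fun u => by
    induction u using List.reverseRecOn with
    | nil => exact fun _ => st_nil
    | append_singleton u x ih =>
      intro hu
      have hu' : u.length ≤ s.length := by simp at hu; omega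
      rw [st_concat, ih hu']
      simp only [step, not_lt.2 hu, false_and, if_false]
  have hst_some : ∀ (u : List X) k t, st u = (k, some t) → t <+: u ∧ gUE Q f t < a := fun u => by
    induction u using List.reverseRecOn with
    | nil => intro k t h; simp [st_nil] at h
    | append_singleton u x ih =>
      intro k t h
      rw [st_concat] at h
      rcases hσ : st u with ⟨j, _ | t'⟩ <;> simp only [hσ, step] at h <;> split_ifs at h with hc
      · simp only [Prod.mk.injEq, Option.some.injEq] at h
        obtain ⟨_, rfl⟩ := h
        exact ⟨List.prefix_refl _, hc.2⟩
      · simp at h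
      · simp at h
      · simp only [Prod.mk.injEq, Option.some.injEq] at h
        obtain ⟨_, rfl⟩ := h
        exact ⟨(ih _ _ hσ).1.trans (List.prefix_append _ _), (ih _ _ hσ).2⟩
  refine ⟨fun u => ((ε / a : ℝ) : EReal) * val (st u) u, hK.const_mul hQ (div_pos hε ha), ?_,
    fun ω hbω hfr => ?_⟩
  · simp only [hst_short s le_rfl, val]
    simp only [← EReal.coe_add, ← EReal.coe_mul, EReal.coe_le_coe_iff]
    field_simp
    simp
  let σ : ℕ → ℕ × Option (List X) := fun n => st (seg ω n)
  have hσ : ∀ n, σ (n + 1) = step (seg ω (n + 1)) (σ n) := fun n => by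
    simp only [σ, seg_succ, st_concat]
  have hmono : Monotone fun n => (σ n).1 := monotone_nat_of_le_succ fun n => by
    rw [hσ]
    rcases σ n with ⟨k, _ | t⟩ <;> simp only [step] <;> split_ifs <;> simp
  have hincr : ∀ N, ∃ n ≥ N, (σ N).1 < (σ n).1 := by
    intro N
    by_contra! hcon
    have hfix : ∀ n ≥ N, (σ n).1 = (σ N).1 := fun n hn => (hcon n hn).antisymm (hmono hn)
    have hnone : ∀ n ≥ N, (σ n).2 = none := by
      intro n hn
      by_contra hne
      obtain ⟨t, ht⟩ := Option.ne_none_iff_exists'.1 hne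
      have hstay : ∀ m ≥ n, σ m = ((σ N).1, some t) := fun m hm => by
        induction m, hm using Nat.le_induction with
        | base => exact Prod.ext (hfix n hn) ht
        | succ m hm ih =>
          have h₁ := hfix (m + 1) (by omega)
          rw [hσ, ih] at h₁ ⊢
          simp only [step] at h₁ ⊢
          split_ifs at h₁ ⊢ with hc
          · simp at h₁
          · rfl
      obtain ⟨hpre, hlt⟩ := hst_some _ _ _ (hstay n le_rfl)
      have hev := eventually_lt_of_lt_liminf
        (hbω.trans_le ((hMt t hlt).2 ω (seg_eq_of_isPrefix hpre)))
      obtain ⟨m, hm, hm'⟩ := (hev.and (eventually_ge_atTop (n + 1))).exists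
      obtain ⟨m, rfl⟩ : ∃ j, m = j + 1 := ⟨m - 1, by omega⟩
      have h₁ := hstay (m + 1) (by omega)
      rw [hσ, hstay m (by omega)] at h₁
      simp [step, hm] at h₁
    obtain ⟨m, hm, hm'⟩ := (hfr.and_eventually (eventually_ge_atTop (N + s.length + 1))).exists
    obtain ⟨m, rfl⟩ : ∃ j, m = j + 1 := ⟨m - 1, by omega⟩
    have h₁ := hnone (m + 1) (by omega)
    rw [hσ, show σ m = ((σ m).1, none) from Prod.ext rfl (hnone m (by omega))] at h₁
    have hl : s.length < (seg ω (m + 1)).length := by rw [seg_length]; omega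
    simp [step, hm, hl] at h₁
  have hunbdd : ∀ k, ∃ N, k ≤ (σ N).1 := fun k => by
    induction k with
    | zero => exact ⟨0, Nat.zero_le _⟩
    | succ k ih =>
      obtain ⟨N, hN⟩ := ih
      obtain ⟨n, _, hn⟩ := hincr N
      exact ⟨n, by omega⟩
  rw [EReal.tendsto_nhds_top_iff_real]
  intro c
  obtain ⟨k, hk⟩ := exists_nat_gt (c / (ε / a * (b - a)))
  have hpos : 0 < ε / a := div_pos hε ha
  rw [div_lt_iff₀ (mul_pos hpos (sub_pos.2 hab))] at hk
  obtain ⟨N, hN⟩ := hunbdd k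
  filter_upwards [eventually_ge_atTop N] with n hn
  have hkn : (k : ℝ) ≤ (σ n).1 := by exact_mod_cast hN.trans (hmono hn)
  have hlow : (((σ n).1 * (b - a) : ℝ) : EReal) ≤ val (σ n) (seg ω n) := by
    rcases σ n with ⟨j, _ | t⟩
    · exact le_add_of_nonneg_right (by exact_mod_cast ha.le)
    · exact le_add_of_nonneg_right ((hM t).1 _)
  calc (c : EReal) < ((ε / a * (k * (b - a)) : ℝ) : EReal) := by
        rw [EReal.coe_lt_coe_iff]; linarith
    _ ≤ ((ε / a * ((σ n).1 * (b - a)) : ℝ) : EReal) := by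
        rw [EReal.coe_le_coe_iff]
        have := sub_pos.2 hab
        gcongr
    _ ≤ _ := by
        rw [EReal.coe_mul]
        exact mul_le_mul_of_nonneg_left hlow (by exact_mod_cast hpos.le)

/-- Countably many divergence conditions can be met by one supermartingale of small capital. -/
theorem exists_nonnegSupermartingale_tendsto_top_of_countable [Finite X]
    (hQ : ∀ s, IsUpperExpectation (Q s)) {ι : Type*} [Countable ι] (s : List X)
    (N : ι → Set (ℕ → X))
    (hN : ∀ i, ∀ ε : ℝ, 0 < ε → ∃ T, IsNonnegSupermartingale Q T ∧ T s ≤ ε ∧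
      ∀ ω ∈ N i, Tendsto (fun n => T (seg ω n)) atTop (𝓝 ⊤)) {ε : ℝ} (hε : 0 < ε) :
    ∃ T, IsNonnegSupermartingale Q T ∧ T s ≤ ε ∧
      ∀ i, ∀ ω ∈ N i, Tendsto (fun n => T (seg ω n)) atTop (𝓝 ⊤) := by
  rcases isEmpty_or_nonempty ι with hι | hι
  · exact ⟨_, IsNonnegSupermartingale.const hQ hε.le, le_rfl, fun i => hι.elim i⟩
  obtain ⟨e, he⟩ := exists_surjective_nat ι
  choose T hT hTs hTN using fun j : ℕ => hN (e j) (ε / 2 / 2 ^ j) (by positivity)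
  have hle : ∀ j u, T j u ≤ ⨆ n, ∑ i ∈ Finset.range n, T i u := fun j u =>
    (Finset.single_le_sum (f := fun i => T i u) (fun i _ => (hT i).1 u)
      (Finset.self_mem_range_succ j)).trans
      (le_iSup (fun n => ∑ i ∈ Finset.range n, T i u) (j + 1))
  refine ⟨_, IsNonnegSupermartingale.iSup hQ (IsNonnegSupermartingale.sum hQ hT) ?_, ?_, ?_⟩
  · exact fun m n hmn u => Finset.sum_le_sum_of_subset_of_nonneg
      (Finset.range_mono hmn) fun i _ _ => (hT i).1 u
  · refine iSup_le fun n => ?_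
    have hsum : ∀ n : ℕ, ∑ i ∈ Finset.range n, T i s ≤ ((ε - ε / 2 ^ n : ℝ) : EReal) := fun n => by
      induction n with
      | zero => simp
      | succ n ih =>
        rw [Finset.sum_range_succ]
        refine (add_le_add ih (hTs n)).trans ?_
        rw [← EReal.coe_add, EReal.coe_le_coe_iff, pow_succ]
        apply le_of_eq
        field_simp
        ring
    refine (hsum n).trans ?_
    rw [EReal.coe_le_coe_iff]
    have : 0 < ε / 2 ^ n := by positivity
    linarith
  · intro i ω hω
    obtain ⟨j, rfl⟩ := he i
    exact tendsto_of_tendsto_of_tendsto_of_le_of_le (hTN j ω hω) tendsto_const_nhds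
      (fun n => hle j _) fun n => le_top

theorem gUE_iSup_le [Finite X] [Nonempty X] (hQ : ∀ s, IsUpperExpectation (Q s))
    (s : List X) {fn : ℕ → (ℕ → X) → EReal} (hf : ∀ n ω, 0 ≤ fn n ω) (hmono : Monotone fn) :
    gUE Q (fun ω => ⨆ n, fn n ω) s ≤ ⨆ n, gUE Q (fn n) s := by
  set g : List X → EReal := fun u => ⨆ n, gUE Q (fn n) u
  have hgS : IsNonnegSupermartingale Q g :=
    IsNonnegSupermartingale.iSup hQ (fun n => isNonnegSupermartingale_gUE hQ (hf n))
      fun m n hmn u => gUE_mono (hmono hmn) u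
  let N : ℕ × {p : ℚ × ℚ // p.1 < p.2} → Set (ℕ → X) := fun i =>
    {ω | ((i.2.1.2 : ℝ) : EReal) < fn i.1 ω ∧
      ∃ᶠ n in atTop, gUE Q (fn i.1) (seg ω n) < ((i.2.1.1 : ℝ) : EReal)}
  have hsmall : ∀ ε : ℝ, 0 < ε → gUE Q (fun ω => ⨆ n, fn n ω) s ≤ g s + ε := by
    intro ε hε
    obtain ⟨T, hT, hTs, hTN⟩ := exists_nonnegSupermartingale_tendsto_top_of_countable hQ s N
      (fun i δ hδ => by
        obtain ⟨T, h₁, h₂, h₃⟩ := exists_nonnegSupermartingale_tendsto_top hQ (hf i.1) s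
          (a := i.2.1.1) (b := i.2.1.2) (by exact_mod_cast i.2.2) hδ
        exact ⟨T, h₁, h₂, fun ω hω => h₃ ω hω.1 hω.2⟩) hε
    refine le_trans (sInf_le ⟨fun u => g u + T u, (hgS.add hQ hT).isSupermartingale,
      fun ω _ => ?_, rfl⟩) (add_le_add le_rfl hTs)
    by_cases hω : ⨆ n, fn n ω ≤ liminf (fun n => g (seg ω n)) atTop
    · exact hω.trans (liminf_le_liminf
        (Eventually.of_forall fun n => le_add_of_nonneg_right (hT.1 _)))
    · push Not at hω
      obtain ⟨a, ha₁, ha₂⟩ := EReal.lt_iff_exists_rat_btwn.1 hω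
      obtain ⟨b, hb₁, hb₂⟩ := EReal.lt_iff_exists_rat_btwn.1 ha₂
      obtain ⟨n, hn⟩ := lt_iSup_iff.1 hb₂
      have hab : a < b := by exact_mod_cast hb₁
      have htop : Tendsto (fun n => T (seg ω n)) atTop (𝓝 ⊤) :=
        hTN (n, ⟨(a, b), hab⟩) ω ⟨hn, (frequently_lt_of_liminf_lt (by isBoundedDefault) ha₁).mono
          fun m hm => (le_iSup (fun n => gUE Q (fn n) (seg ω m)) n).trans_lt hm⟩
      have : Tendsto (fun n => g (seg ω n) + T (seg ω n)) atTop (𝓝 ⊤) :=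
        tendsto_of_tendsto_of_tendsto_of_le_of_le htop tendsto_const_nhds
          (fun n => le_add_of_nonneg_left (hgS.1 _)) fun n => le_top
      rw [this.liminf_eq]
      exact le_top
  refine EReal.le_of_forall_lt_iff_le.1 fun r hr => ?_
  have hg0 := hgS.1 s
  change g s < r at hr
  generalize g s = z at *
  lift z to ℝ using ⟨hr.ne_top, ne_bot_of_le_ne_bot (by simp) hg0⟩
  have hzr : z < r := by exact_mod_cast hr
  refine (hsmall (r - z) (sub_pos.2 hzr)).trans_eq ?_
  rw [← EReal.coe_add]
  congr 1
  ring

theorem gUE_add_const_le (hQ : ∀ s, IsUpperExpectation (Q s)) (f : (ℕ → X) → EReal) (c : ℝ)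
    (s : List X) : gUE Q (fun ω => f ω + c) s ≤ gUE Q f s + c := by
  rw [← EReal.sub_le_iff_le_add (.inl (EReal.coe_ne_bot c)) (.inl (EReal.coe_ne_top c))]
  refine le_sInf fun y ⟨M, hM, hl, hy⟩ => ?_
  rw [EReal.sub_le_iff_le_add (.inl (EReal.coe_ne_bot c)) (.inl (EReal.coe_ne_top c)), ← hy]
  refine sInf_le ⟨_, hM.add_const hQ c, fun ω hω => ?_, rfl⟩
  have hc : Continuous fun z : EReal => z + c := by
    refine continuous_iff_continuousAt.2 fun z => ?_
    exact (EReal.continuousAt_add (p := (z, (c : EReal))) (by simp) (by simp)).comp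
      (f := fun z : EReal => (z, (c : EReal))) (by fun_prop)
  have := Monotone.map_liminf_of_continuousAt (F := atTop) (f := fun z : EReal => z + c)
    (fun _ _ h => add_le_add_left h _) (fun n => M (seg ω n)) hc.continuousAt
  simp only [Function.comp_def] at this
  rw [← this]
  exact add_le_add_left (hl ω hω) _

end Supermartingale

/-- Theorem 4: the game-theoretic upper expectation is continuous with respect to
non-decreasing sequences of bounded-below extended-real variables. -/
theorem stmt17 {X : Type*} [Fintype X] [Nonempty X]
    (Q : List X → (X → EReal) → EReal) (hQ : ∀ s, IsUpperExpectation (Q s))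
    (s : List X) (fn : ℕ → (ℕ → X) → EReal)
    (hb : ∀ n, BddBelowF (fn n)) (hmono : Monotone fn)
    (f : (ℕ → X) → EReal)
    (hlim : ∀ ω, Tendsto (fun n => fn n ω) atTop (𝓝 (f ω))) :
    Tendsto (fun n => gUE Q (fn n) s) atTop (𝓝 (gUE Q f s)) := by
  obtain ⟨B, hB⟩ := hb 0
  have hBn : ∀ n ω, (B : EReal) ≤ fn n ω := fun n ω => (hB ω).trans (hmono n.zero_le ω)
  have hfsup : f = fun ω => ⨆ n, fn n ω := funext fun ω =>
    tendsto_nhds_unique (hlim ω) (tendsto_atTop_iSup fun m n hmn => hmono hmn ω)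
  have hle : gUE Q f s ≤ ⨆ n, gUE Q (fn n) s := by
    have hcancel : ∀ z : EReal, z + ((-B : ℝ) : EReal) + (B : EReal) = z := fun z => by
      rw [add_assoc, ← EReal.coe_add]; simp
    have hnn := gUE_iSup_le hQ s (fn := fun n ω => fn n ω + ((-B : ℝ) : EReal))
      (fun n ω => by
        have := add_le_add_left (hBn n ω) ((-B : ℝ) : EReal)
        rw [← EReal.coe_add] at this
        simpa using this)
      (fun m n hmn ω => add_le_add_left (hmono hmn ω) _)
    calc gUE Q f s
        ≤ gUE Q (fun ω => (⨆ n, fn n ω + ((-B : ℝ) : EReal)) + (B : EReal)) s := by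
          refine gUE_mono (fun ω => ?_) s
          rw [hfsup]
          refine iSup_le fun n => ?_
          rw [← hcancel (fn n ω)]
          gcongr
          exact le_iSup (fun n => fn n ω + ((-B : ℝ) : EReal)) n
      _ ≤ (⨆ n, gUE Q (fun ω => fn n ω + ((-B : ℝ) : EReal)) s) + (B : EReal) :=
          (gUE_add_const_le hQ _ B s).trans (add_le_add_left hnn _)
      _ ≤ (⨆ n, gUE Q (fn n) s) + ((-B : ℝ) : EReal) + (B : EReal) := by
          gcongr
          refine iSup_le fun n => (gUE_add_const_le hQ _ _ s).trans ?_
          gcongr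
          exact le_iSup (fun n => gUE Q (fn n) s) n
      _ = _ := hcancel _
  have heq : gUE Q f s = ⨆ n, gUE Q (fn n) s := by
    refine hle.antisymm (iSup_le fun n => gUE_mono (fun ω => ?_) s)
    rw [hfsup]
    exact le_iSup (fun n => fn n ω) n
  rw [heq]
  exact tendsto_atTop_iSup fun m n hmn => gUE_mono (hmono hmn) s
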